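/- The algebra U_{r,s}(sp_{2n}) is a Hopf algebra, with comultiplication, counit and antipode determined on generators by Δ(ω_i^{±1}) = ω_i^{±1} ⊗ ω_i^{±1}, Δ(ω_i'^{±1}) = ω_i'^{±1} ⊗ ω_i'^{±1}, Δ(e_i) = e_i ⊗ 1 + ω_i ⊗ e_i, Δ(f_i) = 1 ⊗ f_i + f_i ⊗ ω_i', ε(ω_i^{±1}) = ε(ω_i'^{±1}) = 1, ε(e_i) = ε(f_i) = 0, S(ω_i^{±1}) = ω_i^{∓1}, S(ω_i'^{±1}) = ω_i'^{∓1}, S(e_i) = −ω_i^{-1}e_i, S(f_i) = −f_i ω_i'^{-1}; i.e., these assignments extend to well-defined algebra homomorphisms Δ : U → U ⊗ U and ε : U → K and an algebra antihomomorphism S : U → U satisfying the coassociativity, counit and antipode axioms of a Hopf algebra. -/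

import Mathlib

/-!
STATEMENT 1.  The two-parameter quantum group U = U_{r,s}(sp_{2n}) (type Cₙ; here the
rank is n+1 for a parameter n : ℕ, and all indices are 0-based, the last simple root
being α_n = 2ε_n) is a Hopf algebra, with comultiplication, counit and antipode
determined on generators by
Δ(ω_i^{±1}) = ω_i^{±1} ⊗ ω_i^{±1}, Δ(ω_i'^{±1}) = ω_i'^{±1} ⊗ ω_i'^{±1},
Δ(e_i) = e_i ⊗ 1 + ω_i ⊗ e_i, Δ(f_i) = 1 ⊗ f_i + f_i ⊗ ω_i',
ε(ω_i^{±1}) = ε(ω_i'^{±1}) = 1, ε(e_i) = ε(f_i) = 0,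
S(ω_i^{±1}) = ω_i^{∓1}, S(ω_i'^{±1}) = ω_i'^{∓1}, S(e_i) = −ω_i⁻¹e_i,
S(f_i) = −f_iω_i'⁻¹, satisfying the coassociativity, counit and antipode axioms.
-/

noncomputable section
open scoped TensorProduct

/-- K = ℚ(r,s) -/
abbrev KK : Type := FractionRing (MvPolynomial (Fin 2) ℚ)
def qr : KK := algebraMap (MvPolynomial (Fin 2) ℚ) KK (MvPolynomial.X 0)
def qs : KK := algebraMap (MvPolynomial (Fin 2) ℚ) KK (MvPolynomial.X 1)

/-- generators e_i, f_i, ω_i^{±1}, ω_i'^{±1} -/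
inductive Gen (N : ℕ)
  | e (i : Fin N) | f (i : Fin N)
  | w (i : Fin N) | winv (i : Fin N) | wp (i : Fin N) | wpinv (i : Fin N)

def Gen.toral {N : ℕ} : Gen N → Prop
  | .e _ => False
  | .f _ => False
  | _ => True

/-- (ε_j, α_i) for type Cₙ of rank n+1 (0-indexed; α_i = ε_i − ε_{i+1} for i < n,
α_n = 2ε_n). -/
def ipaC (n : ℕ) (j i : ℕ) : ℤ :=
  if i < n then (if j = i then 1 else 0) - (if j = i+1 then 1 else 0)
  else (if j = n then 2 else 0)

/-- r_i = r^{(α_i,α_i)/2} : r_i = ρ for i < n and r_n = ρ². -/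
def riC (n : ℕ) (ρ : KK) (i : ℕ) : KK := if i < n then ρ else ρ^2

abbrev FC (n : ℕ) : Type := FreeAlgebra KK (Gen (n+1))
abbrev XC {n : ℕ} : Gen (n+1) → FC n := FreeAlgebra.ι KK

/-- The defining relations (C1)–(C7) of U_{r,s}(sp_{2(n+1)}). -/
inductive RelC (n : ℕ) : FC n → FC n → Prop
  -- (C1)
  | comm (g g' : Gen (n+1)) (hg : g.toral) (hg' : g'.toral) :
      RelC n (XC g * XC g') (XC g' * XC g)
  | winv_r (i : Fin (n+1)) : RelC n (XC (.w i) * XC (.winv i)) 1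
  | winv_l (i : Fin (n+1)) : RelC n (XC (.winv i) * XC (.w i)) 1
  | wpinv_r (i : Fin (n+1)) : RelC n (XC (.wp i) * XC (.wpinv i)) 1
  | wpinv_l (i : Fin (n+1)) : RelC n (XC (.wpinv i) * XC (.wp i)) 1
  -- (C2)
  | c2we (i j : Fin (n+1)) (hj : (j:ℕ) < n) :
      RelC n (XC (.w j) * XC (.e i) * XC (.winv j))
        ((qr^(ipaC n j i) * qs^(ipaC n ((j:ℕ)+1) i)) • XC (.e i))
  | c2wf (i j : Fin (n+1)) (hj : (j:ℕ) < n) :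
      RelC n (XC (.w j) * XC (.f i) * XC (.winv j))
        ((qr^(-(ipaC n j i)) * qs^(-(ipaC n ((j:ℕ)+1) i))) • XC (.f i))
  | c2wne (j : Fin (n+1)) (hj : (j:ℕ) < n) :
      RelC n (XC (.w (Fin.last n)) * XC (.e j) * XC (.winv (Fin.last n)))
        ((qr^(2 * ipaC n n j)) • XC (.e j))
  | c2wnf (j : Fin (n+1)) (hj : (j:ℕ) < n) :
      RelC n (XC (.w (Fin.last n)) * XC (.f j) * XC (.winv (Fin.last n)))
        ((qr^(-(2 * ipaC n n j))) • XC (.f j))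
  | c2wnen :
      RelC n (XC (.w (Fin.last n)) * XC (.e (Fin.last n)) * XC (.winv (Fin.last n)))
        ((qr^2 * qs^(-2:ℤ)) • XC (.e (Fin.last n)))
  | c2wnfn :
      RelC n (XC (.w (Fin.last n)) * XC (.f (Fin.last n)) * XC (.winv (Fin.last n)))
        ((qr^(-2:ℤ) * qs^2) • XC (.f (Fin.last n)))
  -- (C3)
  | c3wpe (i j : Fin (n+1)) (hj : (j:ℕ) < n) :
      RelC n (XC (.wp j) * XC (.e i) * XC (.wpinv j))
        ((qs^(ipaC n j i) * qr^(ipaC n ((j:ℕ)+1) i)) • XC (.e i))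
  | c3wpf (i j : Fin (n+1)) (hj : (j:ℕ) < n) :
      RelC n (XC (.wp j) * XC (.f i) * XC (.wpinv j))
        ((qs^(-(ipaC n j i)) * qr^(-(ipaC n ((j:ℕ)+1) i))) • XC (.f i))
  | c3wpne (j : Fin (n+1)) (hj : (j:ℕ) < n) :
      RelC n (XC (.wp (Fin.last n)) * XC (.e j) * XC (.wpinv (Fin.last n)))
        ((qs^(2 * ipaC n n j)) • XC (.e j))
  | c3wpnf (j : Fin (n+1)) (hj : (j:ℕ) < n) :
      RelC n (XC (.wp (Fin.last n)) * XC (.f j) * XC (.wpinv (Fin.last n)))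
        ((qs^(-(2 * ipaC n n j))) • XC (.f j))
  | c3wpnen :
      RelC n (XC (.wp (Fin.last n)) * XC (.e (Fin.last n)) * XC (.wpinv (Fin.last n)))
        ((qs^2 * qr^(-2:ℤ)) • XC (.e (Fin.last n)))
  | c3wpnfn :
      RelC n (XC (.wp (Fin.last n)) * XC (.f (Fin.last n)) * XC (.wpinv (Fin.last n)))
        ((qs^(-2:ℤ) * qr^2) • XC (.f (Fin.last n)))
  -- (C4)
  | c4 (i j : Fin (n+1)) :
      RelC n (XC (.e i) * XC (.f j) - XC (.f j) * XC (.e i))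
        (if i = j then (riC n qr i - riC n qs i)⁻¹ • (XC (.w i) - XC (.wp i)) else 0)
  -- (C5)
  | c5e (i j : Fin (n+1)) (h : (i:ℕ)+1 < j ∨ (j:ℕ)+1 < i) :
      RelC n (XC (.e i) * XC (.e j) - XC (.e j) * XC (.e i)) 0
  | c5f (i j : Fin (n+1)) (h : (i:ℕ)+1 < j ∨ (j:ℕ)+1 < i) :
      RelC n (XC (.f i) * XC (.f j) - XC (.f j) * XC (.f i)) 0
  -- (C6)
  | c6a (i j : Fin (n+1)) (hij : (j:ℕ) = (i:ℕ)+1) (h : (i:ℕ)+1 < n) :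
      RelC n (XC (.e i)^2 * XC (.e j) - (qr + qs) • (XC (.e i) * XC (.e j) * XC (.e i))
        + (qr*qs) • (XC (.e j) * XC (.e i)^2)) 0
  | c6b (i j : Fin (n+1)) (hij : (j:ℕ) = (i:ℕ)+1) (h : (i:ℕ)+1 < n) :
      RelC n (XC (.e j)^2 * XC (.e i) - (qr⁻¹ + qs⁻¹) • (XC (.e j) * XC (.e i) * XC (.e j))
        + (qr*qs)⁻¹ • (XC (.e i) * XC (.e j)^2)) 0
  | c6c (i : Fin (n+1)) (h : (i:ℕ)+1 = n) :
      RelC n (XC (.e i)^3 * XC (.e (Fin.last n))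
        - (qr^2 + qr*qs + qs^2) • (XC (.e i)^2 * XC (.e (Fin.last n)) * XC (.e i))
        + (qr*qs*(qr^2 + qr*qs + qs^2)) • (XC (.e i) * XC (.e (Fin.last n)) * XC (.e i)^2)
        - (qr*qs)^3 • (XC (.e (Fin.last n)) * XC (.e i)^3)) 0
  | c6d (i : Fin (n+1)) (h : (i:ℕ)+1 = n) :
      RelC n (XC (.e (Fin.last n))^2 * XC (.e i)
        - ((riC n qr n)⁻¹ + (riC n qs n)⁻¹) • (XC (.e (Fin.last n)) * XC (.e i) * XC (.e (Fin.last n)))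
        + (riC n qr n * riC n qs n)⁻¹ • (XC (.e i) * XC (.e (Fin.last n))^2)) 0
  -- (C7)
  | c7a (i j : Fin (n+1)) (hij : (j:ℕ) = (i:ℕ)+1) (h : (i:ℕ)+1 < n) :
      RelC n (XC (.f j) * XC (.f i)^2 - (qr + qs) • (XC (.f i) * XC (.f j) * XC (.f i))
        + (qr*qs) • (XC (.f i)^2 * XC (.f j))) 0
  | c7b (i j : Fin (n+1)) (hij : (j:ℕ) = (i:ℕ)+1) (h : (i:ℕ)+1 < n) :
      RelC n (XC (.f i) * XC (.f j)^2 - (qr⁻¹ + qs⁻¹) • (XC (.f j) * XC (.f i) * XC (.f j))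
        + (qr*qs)⁻¹ • (XC (.f j)^2 * XC (.f i))) 0
  | c7c (i : Fin (n+1)) (h : (i:ℕ)+1 = n) :
      RelC n (XC (.f (Fin.last n)) * XC (.f i)^3
        - (qr^2 + qr*qs + qs^2) • (XC (.f i) * XC (.f (Fin.last n)) * XC (.f i)^2)
        + (qr*qs*(qr^2 + qr*qs + qs^2)) • (XC (.f i)^2 * XC (.f (Fin.last n)) * XC (.f i))
        - (qr*qs)^3 • (XC (.f i)^3 * XC (.f (Fin.last n)))) 0
  | c7d (i : Fin (n+1)) (h : (i:ℕ)+1 = n) :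
      RelC n (XC (.f i) * XC (.f (Fin.last n))^2
        - ((riC n qr n)⁻¹ + (riC n qs n)⁻¹) • (XC (.f (Fin.last n)) * XC (.f i) * XC (.f (Fin.last n)))
        + (riC n qr n * riC n qs n)⁻¹ • (XC (.f (Fin.last n))^2 * XC (.f i))) 0

/-- U_{r,s}(sp_{2(n+1)}) -/
abbrev UC (n : ℕ) : Type := RingQuot (RelC n)

def genC (n : ℕ) (g : Gen (n+1)) : UC n := RingQuot.mkAlgHom KK (RelC n) (XC g)

open MulOpposite

section Serre
variable {K A : Type*} [Field K] [Ring A] [Algebra K A]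

/-- The quadratic `q`-Serre expression `(ad x)² y` for braiding scalars `q = q_xx`, `p = q_xy`. -/
def serre₂ (q p : K) (x y : A) : A :=
  x ^ 2 * y - (p * (1 + q)) • (x * y * x) + (p ^ 2 * q) • (y * x ^ 2)

/-- The quadratic `q`-Serre expression with all products reversed. -/
def serre₂Rev (q p : K) (x y : A) : A :=
  y * x ^ 2 - (p * (1 + q)) • (x * y * x) + (p ^ 2 * q) • (x ^ 2 * y)

/-- The cubic `q`-Serre expression `(ad x)³ y` for braiding scalars `q = q_xx`, `p = q_xy`. -/
def serre₃ (q p : K) (x y : A) : A :=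
  x ^ 3 * y - (p * (1 + q + q ^ 2)) • (x ^ 2 * y * x)
    + (p ^ 2 * q * (1 + q + q ^ 2)) • (x * y * x ^ 2) - (p * q) ^ 3 • (y * x ^ 3)

/-- The cubic `q`-Serre expression with all products reversed. -/
def serre₃Rev (q p : K) (x y : A) : A :=
  y * x ^ 3 - (p * (1 + q + q ^ 2)) • (x * y * x ^ 2)
    + (p ^ 2 * q * (1 + q + q ^ 2)) • (x ^ 2 * y * x) - (p * q) ^ 3 • (x ^ 3 * y)

lemma op_serre₂ (q p : K) (x y : A) :
    op (serre₂ q p x y) = serre₂Rev q p (op x) (op y) := by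
  simp [serre₂, serre₂Rev, mul_assoc]

lemma op_serre₂Rev (q p : K) (x y : A) :
    op (serre₂Rev q p x y) = serre₂ q p (op x) (op y) := by
  simp [serre₂, serre₂Rev, mul_assoc]

lemma op_serre₃ (q p : K) (x y : A) :
    op (serre₃ q p x y) = serre₃Rev q p (op x) (op y) := by
  simp [serre₃, serre₃Rev, mul_assoc]

lemma op_serre₃Rev (q p : K) (x y : A) :
    op (serre₃Rev q p x y) = serre₃ q p (op x) (op y) := by
  simp [serre₃, serre₃Rev, mul_assoc]

/-- Rewriting rule under right multiplication derived from a `q`-commutation relation. -/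
lemma qcomm_assoc {a : K} {x y : A} (h : x * y = a • (y * x)) (z : A) :
    x * (y * z) = a • (y * (x * z)) := by
  rw [← mul_assoc, h, smul_mul_assoc, mul_assoc]

lemma serre₂_add {q p t : K} {x y X Y : A} (h : q * p * t = 1)
    (hXx : X * x = q • (x * X)) (hXy : X * y = p • (y * X)) (hYx : Y * x = t • (x * Y))
    (hxy : serre₂ q p x y = 0) (hXY : serre₂ q p X Y = 0) :
    serre₂ q p (x + X) (y + Y) = 0 := by
  rw [← add_zero (0 : A)]
  nth_rewrite 1 [← hxy]
  rw [← hXY]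
  simp only [serre₂, pow_succ, pow_zero, one_mul, mul_add, add_mul, mul_assoc, smul_mul_assoc,
    mul_smul_comm, smul_smul, smul_add, hXx, hXy, hYx, qcomm_assoc hXx, qcomm_assoc hXy,
    qcomm_assoc hYx]
  match_scalars <;> grind

lemma serre₃_add {q p t : K} {x y X Y : A} (h : q ^ 2 * p * t = 1)
    (hXx : X * x = q • (x * X)) (hXy : X * y = p • (y * X)) (hYx : Y * x = t • (x * Y))
    (hxy : serre₃ q p x y = 0) (hXY : serre₃ q p X Y = 0) :
    serre₃ q p (x + X) (y + Y) = 0 := by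
  rw [← add_zero (0 : A)]
  nth_rewrite 1 [← hxy]
  rw [← hXY]
  simp only [serre₃, pow_succ, pow_zero, one_mul, mul_add, add_mul, mul_assoc, smul_mul_assoc,
    mul_smul_comm, smul_smul, smul_add, hXx, hXy, hYx, qcomm_assoc hXx, qcomm_assoc hXy,
    qcomm_assoc hYx]
  match_scalars <;> grind

lemma serre₂Rev_add {q p t : K} {x y X Y : A} (h : q * p * t = 1)
    (hxX : x * X = q • (X * x)) (hyX : y * X = p • (X * y)) (hxY : x * Y = t • (Y * x))
    (hxy : serre₂Rev q p x y = 0) (hXY : serre₂Rev q p X Y = 0) :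
    serre₂Rev q p (x + X) (y + Y) = 0 := by
  apply op_injective
  rw [op_serre₂Rev, op_zero, op_add, op_add]
  refine serre₂_add h ?_ ?_ ?_ ?_ ?_
  · simp only [← op_mul, ← op_smul, hxX]
  · simp only [← op_mul, ← op_smul, hyX]
  · simp only [← op_mul, ← op_smul, hxY]
  · rw [← op_serre₂Rev, hxy, op_zero]
  · rw [← op_serre₂Rev, hXY, op_zero]

lemma serre₃Rev_add {q p t : K} {x y X Y : A} (h : q ^ 2 * p * t = 1)
    (hxX : x * X = q • (X * x)) (hyX : y * X = p • (X * y)) (hxY : x * Y = t • (Y * x))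
    (hxy : serre₃Rev q p x y = 0) (hXY : serre₃Rev q p X Y = 0) :
    serre₃Rev q p (x + X) (y + Y) = 0 := by
  apply op_injective
  rw [op_serre₃Rev, op_zero, op_add, op_add]
  refine serre₃_add h ?_ ?_ ?_ ?_ ?_
  · simp only [← op_mul, ← op_smul, hxX]
  · simp only [← op_mul, ← op_smul, hyX]
  · simp only [← op_mul, ← op_smul, hxY]
  · rw [← op_serre₃Rev, hxy, op_zero]
  · rw [← op_serre₃Rev, hXY, op_zero]

lemma serre₂Rev_neg_mul {q p a b t : K} {x y u v : A} (hp : b ^ 2 * a = p ^ 2 * q)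
    (ht : t * b * a = 1) (huv : v * u = u * v)
    (hxu : x * u = a • (u * x)) (hyu : y * u = b • (u * y)) (hxv : x * v = t • (v * x))
    (hxy : serre₂ q p x y = 0) :
    serre₂Rev q p (-(u * x)) (-(v * y)) = 0 := by
  have h : -(u * (u * (v * serre₂ q p x y))) = 0 := by simp [hxy]
  rw [← h]
  have huv' : v * u = (1 : K) • (u * v) := by rw [huv, one_smul]
  simp only [serre₂, serre₂Rev, pow_succ, pow_zero, one_mul, mul_add, mul_sub, mul_assoc,
    smul_mul_assoc, mul_smul_comm, smul_smul, neg_mul, mul_neg, neg_neg,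
    qcomm_assoc hxu, qcomm_assoc hyu, qcomm_assoc hxv, qcomm_assoc huv', smul_neg]
  match_scalars <;> grind

lemma serre₃Rev_neg_mul {q p a b t : K} {x y u v : A} (hp : b * a = p * q)
    (ht : t * b * a ^ 2 = 1) (huv : v * u = u * v)
    (hxu : x * u = a • (u * x)) (hyu : y * u = b • (u * y)) (hxv : x * v = t • (v * x))
    (hxy : serre₃ q p x y = 0) :
    serre₃Rev q p (-(u * x)) (-(v * y)) = 0 := by
  have h : -(u * (u * (u * (v * serre₃ q p x y)))) = 0 := by simp [hxy]
  rw [← h]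
  have huv' : v * u = (1 : K) • (u * v) := by rw [huv, one_smul]
  simp only [serre₃, serre₃Rev, pow_succ, pow_zero, one_mul, mul_add, mul_sub, mul_assoc,
    smul_mul_assoc, mul_smul_comm, smul_smul, neg_mul, mul_neg, neg_neg,
    qcomm_assoc hxu, qcomm_assoc hyu, qcomm_assoc hxv, qcomm_assoc huv', smul_neg]
  match_scalars <;> grind

lemma serre₂_neg_mul {q p a b t : K} {x y u v : A} (hp : b ^ 2 * a = p ^ 2 * q)
    (ht : t * b * a = 1) (huv : u * v = v * u)
    (hux : u * x = a • (x * u)) (huy : u * y = b • (y * u)) (hvx : v * x = t • (x * v))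
    (hxy : serre₂Rev q p x y = 0) :
    serre₂ q p (-(x * u)) (-(y * v)) = 0 := by
  apply op_injective
  rw [op_serre₂, op_zero, op_neg, op_neg, op_mul, op_mul]
  refine serre₂Rev_neg_mul hp ht ?_ ?_ ?_ ?_ ?_
  · simp only [← op_mul, huv]
  · simp only [← op_mul, ← op_smul, hux]
  · simp only [← op_mul, ← op_smul, huy]
  · simp only [← op_mul, ← op_smul, hvx]
  · rw [← op_serre₂Rev, hxy, op_zero]

lemma serre₃_neg_mul {q p a b t : K} {x y u v : A} (hp : b * a = p * q)
    (ht : t * b * a ^ 2 = 1) (huv : u * v = v * u)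
    (hux : u * x = a • (x * u)) (huy : u * y = b • (y * u)) (hvx : v * x = t • (x * v))
    (hxy : serre₃Rev q p x y = 0) :
    serre₃ q p (-(x * u)) (-(y * v)) = 0 := by
  apply op_injective
  rw [op_serre₃, op_zero, op_neg, op_neg, op_mul, op_mul]
  refine serre₃Rev_neg_mul hp ht ?_ ?_ ?_ ?_ ?_
  · simp only [← op_mul, huv]
  · simp only [← op_mul, ← op_smul, hux]
  · simp only [← op_mul, ← op_smul, huy]
  · simp only [← op_mul, ← op_smul, hvx]
  · rw [← op_serre₃Rev, hxy, op_zero]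

lemma serre₂_tmul_right (q p : K) {u v : A} (x y : A) (huv : v * u = u * v) :
    serre₂ q p (u ⊗ₜ[K] x) (v ⊗ₜ[K] y) = (u * (u * v)) ⊗ₜ[K] serre₂ q p x y := by
  have huv' (z : A) : v * (u * z) = u * (v * z) := by rw [← mul_assoc, huv, mul_assoc]
  simp only [serre₂, pow_succ, pow_zero, one_mul, Algebra.TensorProduct.tmul_mul_tmul,
    mul_assoc, huv, huv', TensorProduct.tmul_add, TensorProduct.tmul_sub,
    TensorProduct.tmul_smul]

lemma serre₃_tmul_right (q p : K) {u v : A} (x y : A) (huv : v * u = u * v) :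
    serre₃ q p (u ⊗ₜ[K] x) (v ⊗ₜ[K] y) = (u * (u * (u * v))) ⊗ₜ[K] serre₃ q p x y := by
  have huv' (z : A) : v * (u * z) = u * (v * z) := by rw [← mul_assoc, huv, mul_assoc]
  simp only [serre₃, pow_succ, pow_zero, one_mul, Algebra.TensorProduct.tmul_mul_tmul,
    mul_assoc, huv, huv', TensorProduct.tmul_add, TensorProduct.tmul_sub,
    TensorProduct.tmul_smul]

lemma serre₂Rev_tmul_left (q p : K) {u v : A} (x y : A) (huv : v * u = u * v) :
    serre₂Rev q p (x ⊗ₜ[K] u) (y ⊗ₜ[K] v) = serre₂Rev q p x y ⊗ₜ[K] (u * (u * v)) := by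
  have huv' (z : A) : v * (u * z) = u * (v * z) := by rw [← mul_assoc, huv, mul_assoc]
  simp only [serre₂Rev, pow_succ, pow_zero, one_mul, Algebra.TensorProduct.tmul_mul_tmul,
    mul_assoc, huv, huv', TensorProduct.add_tmul, TensorProduct.sub_tmul,
    TensorProduct.smul_tmul']

lemma serre₃Rev_tmul_left (q p : K) {u v : A} (x y : A) (huv : v * u = u * v) :
    serre₃Rev q p (x ⊗ₜ[K] u) (y ⊗ₜ[K] v) = serre₃Rev q p x y ⊗ₜ[K] (u * (u * (u * v))) := by
  have huv' (z : A) : v * (u * z) = u * (v * z) := by rw [← mul_assoc, huv, mul_assoc]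
  simp only [serre₃Rev, pow_succ, pow_zero, one_mul, Algebra.TensorProduct.tmul_mul_tmul,
    mul_assoc, huv, huv', TensorProduct.add_tmul, TensorProduct.sub_tmul,
    TensorProduct.smul_tmul']

lemma map_serre₂ {B : Type*} [Ring B] [Algebra K B] (g : A →ₐ[K] B) (q p : K) (x y : A) :
    g (serre₂ q p x y) = serre₂ q p (g x) (g y) := by
  simp [serre₂]

lemma map_serre₃ {B : Type*} [Ring B] [Algebra K B] (g : A →ₐ[K] B) (q p : K) (x y : A) :
    g (serre₃ q p x y) = serre₃ q p (g x) (g y) := by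
  simp [serre₃]

lemma map_serre₂Rev {B : Type*} [Ring B] [Algebra K B] (g : A →ₐ[K] B) (q p : K) (x y : A) :
    g (serre₂Rev q p x y) = serre₂Rev q p (g x) (g y) := by
  simp [serre₂Rev]

lemma map_serre₃Rev {B : Type*} [Ring B] [Algebra K B] (g : A →ₐ[K] B) (q p : K) (x y : A) :
    g (serre₃Rev q p x y) = serre₃Rev q p (g x) (g y) := by
  simp [serre₃Rev]

end Serre

section Antipode
variable {K A : Type*} [Field K] [Ring A] [Algebra K A]

lemma mul'_map_left_mul {S : A →ₗ[K] A} (hS : ∀ x y, S (x * y) = S y * S x)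
    {z : A ⊗[K] A} {a : K}
    (hz : LinearMap.mul' K A (TensorProduct.map S LinearMap.id z) = algebraMap K A a)
    (t : A ⊗[K] A) :
    LinearMap.mul' K A (TensorProduct.map S LinearMap.id (z * t))
      = a • LinearMap.mul' K A (TensorProduct.map S LinearMap.id t) := by
  induction t with
  | zero => simp
  | add t t' ht ht' => rw [mul_add, map_add, map_add, ht, ht', map_add, map_add, smul_add]
  | tmul b c =>
    have key (w : A ⊗[K] A) :
        LinearMap.mul' K A (TensorProduct.map S LinearMap.id (w * b ⊗ₜ c))
          = S b * LinearMap.mul' K A (TensorProduct.map S LinearMap.id w) * c := by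
      induction w with
      | zero => simp
      | add w w' hw hw' => rw [add_mul, map_add, map_add, hw, hw', map_add, map_add, mul_add,
          add_mul]
      | tmul d e => simp [hS, mul_assoc]
    rw [key, hz, ← Algebra.commutes, mul_assoc, ← Algebra.smul_def]
    simp

lemma mul'_map_right_mul {S : A →ₗ[K] A} (hS : ∀ x y, S (x * y) = S y * S x)
    {t : A ⊗[K] A} {a : K}
    (ht : LinearMap.mul' K A (TensorProduct.map LinearMap.id S t) = algebraMap K A a)
    (z : A ⊗[K] A) :
    LinearMap.mul' K A (TensorProduct.map LinearMap.id S (z * t))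
      = a • LinearMap.mul' K A (TensorProduct.map LinearMap.id S z) := by
  induction z with
  | zero => simp
  | add z z' hz hz' => rw [add_mul, map_add, map_add, hz, hz', map_add, map_add, smul_add]
  | tmul b c =>
    have key (w : A ⊗[K] A) :
        LinearMap.mul' K A (TensorProduct.map LinearMap.id S (b ⊗ₜ c * w))
          = b * LinearMap.mul' K A (TensorProduct.map LinearMap.id S w) * S c := by
      induction w with
      | zero => simp
      | add w w' hw hw' => rw [mul_add, map_add, map_add, hw, hw', map_add, map_add, mul_add,
          add_mul]
      | tmul d e => simp [hS, mul_assoc]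
    rw [key, ht, ← Algebra.commutes, mul_assoc, ← Algebra.smul_def]
    simp

end Antipode

/-- The scalars of a two-parameter quantum group: the braiding matrix `q`, the coefficients `c` of
the commutators `[e i, f i]`, and the pairs of indices that are orthogonal, respectively satisfy a
quadratic or a cubic Serre relation. -/
structure QuantumDatum (K : Type*) [Field K] (N : ℕ) where
  q : Fin N → Fin N → K
  c : Fin N → K
  Orthogonal : Fin N → Fin N → Prop
  Quadratic : Fin N → Fin N → Prop
  Cubic : Fin N → Fin N → Prop
  q_ne_zero : ∀ i j, q i j ≠ 0
  q_orthogonal : ∀ i j, Orthogonal i j → q i j = 1 ∧ q j i = 1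
  q_quadratic : ∀ i j, Quadratic i j → q i i * q i j * q j i = 1
  q_cubic : ∀ i j, Cubic i j → q i i ^ 2 * q i j * q j i = 1

namespace QuantumDatum

variable {K A B : Type*} [Field K] [Ring A] [Algebra K A] [Ring B] [Algebra K B] {N : ℕ}
  (D : QuantumDatum K N)

/-- The family `φ` of elements of `A` satisfies the defining relations of the quantum group with
datum `D`. -/
structure Realizes (φ : Gen N → A) : Prop where
  comm : ∀ g g', g.toral → g'.toral → φ g * φ g' = φ g' * φ g
  w_winv : ∀ i, φ (.w i) * φ (.winv i) = 1
  winv_w : ∀ i, φ (.winv i) * φ (.w i) = 1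
  wp_wpinv : ∀ i, φ (.wp i) * φ (.wpinv i) = 1
  wpinv_wp : ∀ i, φ (.wpinv i) * φ (.wp i) = 1
  w_e : ∀ j i, φ (.w j) * φ (.e i) = D.q j i • (φ (.e i) * φ (.w j))
  w_f : ∀ j i, φ (.w j) * φ (.f i) = (D.q j i)⁻¹ • (φ (.f i) * φ (.w j))
  wp_e : ∀ j i, φ (.wp j) * φ (.e i) = (D.q i j)⁻¹ • (φ (.e i) * φ (.wp j))
  wp_f : ∀ j i, φ (.wp j) * φ (.f i) = D.q i j • (φ (.f i) * φ (.wp j))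
  e_f : ∀ i j, φ (.e i) * φ (.f j) - φ (.f j) * φ (.e i)
    = if i = j then D.c i • (φ (.w i) - φ (.wp i)) else 0
  e_e : ∀ i j, D.Orthogonal i j → φ (.e i) * φ (.e j) - φ (.e j) * φ (.e i) = 0
  f_f : ∀ i j, D.Orthogonal i j → φ (.f i) * φ (.f j) - φ (.f j) * φ (.f i) = 0
  quadratic_e : ∀ i j, D.Quadratic i j →
    serre₂ (D.q i i) (D.q i j) (φ (.e i)) (φ (.e j)) = 0
  quadratic_f : ∀ i j, D.Quadratic i j →
    serre₂Rev (D.q i i) (D.q i j) (φ (.f i)) (φ (.f j)) = 0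
  cubic_e : ∀ i j, D.Cubic i j → serre₃ (D.q i i) (D.q i j) (φ (.e i)) (φ (.e j)) = 0
  cubic_f : ∀ i j, D.Cubic i j → serre₃Rev (D.q i i) (D.q i j) (φ (.f i)) (φ (.f j)) = 0

lemma swap_of_inverse {a : K} {w v x : A} (hwv : w * v = 1) (hvw : v * w = 1)
    (h : w * x = a • (x * w)) : x * v = a • (v * x) := by
  have : v * (w * x) * v = v * (a • (x * w)) * v := by rw [h]
  rw [← mul_assoc, hvw, one_mul, mul_smul_comm, smul_mul_assoc, mul_assoc, mul_assoc, hwv,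
    mul_one] at this
  exact this

/-- The values of the comultiplication on generators. -/
def comulGen (K : Type*) [Field K] [Algebra K A] (φ : Gen N → A) : Gen N → A ⊗[K] A
  | .e i => φ (.e i) ⊗ₜ 1 + φ (.w i) ⊗ₜ φ (.e i)
  | .f i => 1 ⊗ₜ φ (.f i) + φ (.f i) ⊗ₜ φ (.wp i)
  | .w i => φ (.w i) ⊗ₜ φ (.w i)
  | .winv i => φ (.winv i) ⊗ₜ φ (.winv i)
  | .wp i => φ (.wp i) ⊗ₜ φ (.wp i)
  | .wpinv i => φ (.wpinv i) ⊗ₜ φ (.wpinv i)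

lemma comulGen_of_toral (φ : Gen N → A) {g : Gen N} (hg : g.toral) :
    comulGen K φ g = φ g ⊗ₜ φ g := by
  cases g <;> first | rfl | exact hg.elim

/-- The values of the counit on generators. -/
def counitGen (K : Type*) [Field K] : Gen N → K
  | .e _ => 0
  | .f _ => 0
  | _ => 1

/-- The values of the antipode on generators. -/
def antipodeGen (φ : Gen N → A) : Gen N → Aᵐᵒᵖ
  | .e i => op (-(φ (.winv i) * φ (.e i)))
  | .f i => op (-(φ (.f i) * φ (.wpinv i)))
  | .w i => op (φ (.winv i))
  | .winv i => op (φ (.w i))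
  | .wp i => op (φ (.wpinv i))
  | .wpinv i => op (φ (.wp i))

lemma exists_antipodeGen_of_toral (φ : Gen N → A) {g : Gen N} (hg : g.toral) :
    ∃ g' : Gen N, g'.toral ∧ antipodeGen φ g = op (φ g') := by
  cases g with
  | e => exact hg.elim
  | f => exact hg.elim
  | w i => exact ⟨.winv i, trivial, rfl⟩
  | winv i => exact ⟨.w i, trivial, rfl⟩
  | wp i => exact ⟨.wpinv i, trivial, rfl⟩
  | wpinv i => exact ⟨.wp i, trivial, rfl⟩

namespace Realizes

variable {D} {φ : Gen N → A}

lemma map (h : D.Realizes φ) (g : A →ₐ[K] B) : D.Realizes (g ∘ φ) where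
  comm a b ha hb := by simp only [Function.comp, ← map_mul, h.comm a b ha hb]
  w_winv i := by simp only [Function.comp, ← map_mul, h.w_winv, map_one]
  winv_w i := by simp only [Function.comp, ← map_mul, h.winv_w, map_one]
  wp_wpinv i := by simp only [Function.comp, ← map_mul, h.wp_wpinv, map_one]
  wpinv_wp i := by simp only [Function.comp, ← map_mul, h.wpinv_wp, map_one]
  w_e j i := by simp only [Function.comp, ← map_mul, h.w_e, map_smul]
  w_f j i := by simp only [Function.comp, ← map_mul, h.w_f, map_smul]
  wp_e j i := by simp only [Function.comp, ← map_mul, h.wp_e, map_smul]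
  wp_f j i := by simp only [Function.comp, ← map_mul, h.wp_f, map_smul]
  e_f i j := by
    simp only [Function.comp, ← map_mul, ← map_sub, h.e_f]
    split_ifs <;> simp
  e_e i j hij := by simp only [Function.comp, ← map_mul, ← map_sub, h.e_e i j hij, map_zero]
  f_f i j hij := by simp only [Function.comp, ← map_mul, ← map_sub, h.f_f i j hij, map_zero]
  quadratic_e i j hij := by
    simp only [Function.comp, ← map_serre₂, h.quadratic_e i j hij, map_zero]
  quadratic_f i j hij := by
    simp only [Function.comp, ← map_serre₂Rev, h.quadratic_f i j hij, map_zero]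
  cubic_e i j hij := by
    simp only [Function.comp, ← map_serre₃, h.cubic_e i j hij, map_zero]
  cubic_f i j hij := by
    simp only [Function.comp, ← map_serre₃Rev, h.cubic_f i j hij, map_zero]

lemma w_w (h : D.Realizes φ) (i j : Fin N) :
    φ (.w i) * φ (.w j) = φ (.w j) * φ (.w i) := h.comm _ _ trivial trivial

lemma wp_wp (h : D.Realizes φ) (i j : Fin N) :
    φ (.wp i) * φ (.wp j) = φ (.wp j) * φ (.wp i) := h.comm _ _ trivial trivial

lemma e_winv (h : D.Realizes φ) (i j : Fin N) :
    φ (.e i) * φ (.winv j) = D.q j i • (φ (.winv j) * φ (.e i)) :=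
  swap_of_inverse (h.w_winv j) (h.winv_w j) (h.w_e j i)

lemma f_winv (h : D.Realizes φ) (i j : Fin N) :
    φ (.f i) * φ (.winv j) = (D.q j i)⁻¹ • (φ (.winv j) * φ (.f i)) :=
  swap_of_inverse (h.w_winv j) (h.winv_w j) (h.w_f j i)

lemma e_wpinv (h : D.Realizes φ) (i j : Fin N) :
    φ (.e i) * φ (.wpinv j) = (D.q i j)⁻¹ • (φ (.wpinv j) * φ (.e i)) :=
  swap_of_inverse (h.wp_wpinv j) (h.wpinv_wp j) (h.wp_e j i)

lemma f_wpinv (h : D.Realizes φ) (i j : Fin N) :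
    φ (.f i) * φ (.wpinv j) = D.q i j • (φ (.wpinv j) * φ (.f i)) :=
  swap_of_inverse (h.wp_wpinv j) (h.wpinv_wp j) (h.wp_f j i)

lemma wpinv_e (h : D.Realizes φ) (i j : Fin N) :
    φ (.wpinv j) * φ (.e i) = D.q i j • (φ (.e i) * φ (.wpinv j)) := by
  rw [h.e_wpinv, smul_inv_smul₀ (D.q_ne_zero i j)]

lemma wpinv_f (h : D.Realizes φ) (i j : Fin N) :
    φ (.wpinv j) * φ (.f i) = (D.q i j)⁻¹ • (φ (.f i) * φ (.wpinv j)) := by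
  rw [h.f_wpinv, inv_smul_smul₀ (D.q_ne_zero i j)]

/-- `ω i ⊗ e i` and `e j ⊗ 1` commute up to the braiding scalar. -/
lemma comul_e_swap (h : D.Realizes φ) (i j : Fin N) :
    (φ (.w i) ⊗ₜ[K] φ (.e i)) * (φ (.e j) ⊗ₜ[K] (1 : A))
      = D.q i j • ((φ (.e j) ⊗ₜ[K] (1 : A)) * (φ (.w i) ⊗ₜ[K] φ (.e i))) := by
  simp [h.w_e, TensorProduct.smul_tmul']

/-- `f j ⊗ ω' j` and `1 ⊗ f i` commute up to the braiding scalar. -/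
lemma comul_f_swap (h : D.Realizes φ) (i j : Fin N) :
    (φ (.f j) ⊗ₜ[K] φ (.wp j)) * ((1 : A) ⊗ₜ[K] φ (.f i))
      = D.q i j • (((1 : A) ⊗ₜ[K] φ (.f i)) * (φ (.f j) ⊗ₜ[K] φ (.wp j))) := by
  simp [h.wp_f]

/-- The comultiplication respects the defining relations. -/
lemma comulGen (h : D.Realizes φ) : D.Realizes (comulGen K φ) where
  comm g g' hg hg' := by
    rw [comulGen_of_toral φ hg, comulGen_of_toral φ hg', Algebra.TensorProduct.tmul_mul_tmul,
      Algebra.TensorProduct.tmul_mul_tmul, h.comm g g' hg hg']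
  w_winv i := by
    simp [QuantumDatum.comulGen, h.w_winv, Algebra.TensorProduct.one_def]
  winv_w i := by
    simp [QuantumDatum.comulGen, h.winv_w, Algebra.TensorProduct.one_def]
  wp_wpinv i := by
    simp [QuantumDatum.comulGen, h.wp_wpinv, Algebra.TensorProduct.one_def]
  wpinv_wp i := by
    simp [QuantumDatum.comulGen, h.wpinv_wp, Algebra.TensorProduct.one_def]
  w_e j i := by
    simp [QuantumDatum.comulGen, mul_add, add_mul, h.w_e, h.w_w j i, TensorProduct.smul_tmul']
  w_f j i := by
    simp [QuantumDatum.comulGen, mul_add, add_mul, h.w_f, TensorProduct.smul_tmul',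
      h.comm (.w j) (.wp i) trivial trivial]
  wp_e j i := by
    simp [QuantumDatum.comulGen, mul_add, add_mul, h.wp_e, TensorProduct.smul_tmul',
      h.comm (.wp j) (.w i) trivial trivial]
  wp_f j i := by
    simp [QuantumDatum.comulGen, mul_add, add_mul, h.wp_f, h.wp_wp j i, TensorProduct.smul_tmul']
  e_f i j := by
    have key : (φ (.w i) * φ (.f j)) ⊗ₜ[K] (φ (.e i) * φ (.wp j))
        = (φ (.f j) * φ (.w i)) ⊗ₜ[K] (φ (.wp j) * φ (.e i)) := by
      rw [h.w_f, h.wp_e, TensorProduct.tmul_smul, TensorProduct.smul_tmul']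
    have expand : QuantumDatum.comulGen K φ (.e i) * QuantumDatum.comulGen K φ (.f j)
          - QuantumDatum.comulGen K φ (.f j) * QuantumDatum.comulGen K φ (.e i)
        = (φ (.e i) * φ (.f j) - φ (.f j) * φ (.e i)) ⊗ₜ[K] φ (.wp j)
          + φ (.w i) ⊗ₜ[K] (φ (.e i) * φ (.f j) - φ (.f j) * φ (.e i)) := by
      simp only [QuantumDatum.comulGen, mul_add, add_mul, Algebra.TensorProduct.tmul_mul_tmul,
        mul_one, one_mul, key, TensorProduct.sub_tmul, TensorProduct.tmul_sub]
      abel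
    rw [expand, h.e_f]
    split_ifs with hij
    · subst hij
      simp only [QuantumDatum.comulGen, TensorProduct.tmul_smul, ← TensorProduct.smul_tmul',
        TensorProduct.sub_tmul, TensorProduct.tmul_sub, ← smul_add]
      congr 1
      abel
    · simp
  e_e i j hij := by
    have hq := D.q_orthogonal i j hij
    have hxx := sub_eq_zero.1 (h.e_e i j hij)
    have h₁ := h.comul_e_swap i j
    have h₂ := h.comul_e_swap j i
    rw [hq.1, one_smul] at h₁
    rw [hq.2, one_smul] at h₂
    simp only [QuantumDatum.comulGen, mul_add, add_mul, h₁, h₂]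
    simp only [Algebra.TensorProduct.tmul_mul_tmul, hxx, h.w_w i j]
    abel
  f_f i j hij := by
    have hq := D.q_orthogonal i j hij
    have hxx := sub_eq_zero.1 (h.f_f i j hij)
    have h₁ := h.comul_f_swap i j
    have h₂ := h.comul_f_swap j i
    rw [hq.1, one_smul] at h₁
    rw [hq.2, one_smul] at h₂
    simp only [QuantumDatum.comulGen, mul_add, add_mul, h₁, h₂]
    simp only [Algebra.TensorProduct.tmul_mul_tmul, hxx, h.wp_wp i j]
    abel
  quadratic_e i j hij := by
    refine serre₂_add (D.q_quadratic i j hij) (h.comul_e_swap i i) (h.comul_e_swap i j)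
      (h.comul_e_swap j i) ?_ ?_
    · exact (h.map (Algebra.TensorProduct.includeLeft (R := K) (S := K) (B := A))).quadratic_e
        i j hij
    · rw [serre₂_tmul_right _ _ _ _ (h.w_w j i), h.quadratic_e i j hij, TensorProduct.tmul_zero]
  quadratic_f i j hij := by
    rw [QuantumDatum.comulGen, QuantumDatum.comulGen, add_comm (1 ⊗ₜ[K] _),
      add_comm (1 ⊗ₜ[K] _)]
    refine serre₂Rev_add (D.q_quadratic i j hij) (h.comul_f_swap i i) (h.comul_f_swap i j)
      (h.comul_f_swap j i) ?_ ?_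
    · rw [serre₂Rev_tmul_left _ _ _ _ (h.wp_wp j i), h.quadratic_f i j hij,
        TensorProduct.zero_tmul]
    · exact (h.map (Algebra.TensorProduct.includeRight (R := K) (A := A))).quadratic_f i j hij
  cubic_e i j hij := by
    refine serre₃_add (D.q_cubic i j hij) (h.comul_e_swap i i) (h.comul_e_swap i j)
      (h.comul_e_swap j i) ?_ ?_
    · exact (h.map (Algebra.TensorProduct.includeLeft (R := K) (S := K) (B := A))).cubic_e
        i j hij
    · rw [serre₃_tmul_right _ _ _ _ (h.w_w j i), h.cubic_e i j hij, TensorProduct.tmul_zero]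
  cubic_f i j hij := by
    rw [QuantumDatum.comulGen, QuantumDatum.comulGen, add_comm (1 ⊗ₜ[K] _),
      add_comm (1 ⊗ₜ[K] _)]
    refine serre₃Rev_add (D.q_cubic i j hij) (h.comul_f_swap i i) (h.comul_f_swap i j)
      (h.comul_f_swap j i) ?_ ?_
    · rw [serre₃Rev_tmul_left _ _ _ _ (h.wp_wp j i), h.cubic_f i j hij,
        TensorProduct.zero_tmul]
    · exact (h.map (Algebra.TensorProduct.includeRight (R := K) (A := A))).cubic_f i j hij

/-- The counit respects the defining relations. -/
lemma counitGen : D.Realizes (counitGen (N := N) K) where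
  comm g g' _ _ := mul_comm _ _
  w_winv i := mul_one _
  winv_w i := mul_one _
  wp_wpinv i := mul_one _
  wpinv_wp i := mul_one _
  w_e j i := by simp [QuantumDatum.counitGen]
  w_f j i := by simp [QuantumDatum.counitGen]
  wp_e j i := by simp [QuantumDatum.counitGen]
  wp_f j i := by simp [QuantumDatum.counitGen]
  e_f i j := by simp [QuantumDatum.counitGen]
  e_e i j _ := by simp [QuantumDatum.counitGen]
  f_f i j _ := by simp [QuantumDatum.counitGen]
  quadratic_e i j _ := by simp [QuantumDatum.counitGen, serre₂]
  quadratic_f i j _ := by simp [QuantumDatum.counitGen, serre₂Rev]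
  cubic_e i j _ := by simp [QuantumDatum.counitGen, serre₃]
  cubic_f i j _ := by simp [QuantumDatum.counitGen, serre₃Rev]

/-- The antipode respects the defining relations. -/
lemma antipodeGen (h : D.Realizes φ) : D.Realizes (antipodeGen φ) where
  comm g g' hg hg' := by
    obtain ⟨a, ha, hga⟩ := exists_antipodeGen_of_toral φ hg
    obtain ⟨b, hb, hgb⟩ := exists_antipodeGen_of_toral φ hg'
    rw [hga, hgb, ← op_mul, ← op_mul, h.comm a b ha hb]
  w_winv i := by simp only [QuantumDatum.antipodeGen, ← op_mul, h.w_winv, op_one]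
  winv_w i := by simp only [QuantumDatum.antipodeGen, ← op_mul, h.winv_w, op_one]
  wp_wpinv i := by simp only [QuantumDatum.antipodeGen, ← op_mul, h.wp_wpinv, op_one]
  wpinv_wp i := by simp only [QuantumDatum.antipodeGen, ← op_mul, h.wpinv_wp, op_one]
  w_e j i := by
    simp only [QuantumDatum.antipodeGen, ← op_mul, ← op_smul, neg_mul, mul_neg, smul_neg,
      mul_assoc, h.e_winv, mul_smul_comm]
    rw [← mul_assoc, ← mul_assoc, h.comm (.winv i) (.winv j) trivial trivial]
  w_f j i := by
    simp only [QuantumDatum.antipodeGen, ← op_mul, ← op_smul, neg_mul, mul_neg, smul_neg]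
    rw [mul_assoc, h.comm (.wpinv i) (.winv j) trivial trivial, ← mul_assoc, h.f_winv,
      smul_mul_assoc, mul_assoc]
  wp_e j i := by
    simp only [QuantumDatum.antipodeGen, ← op_mul, ← op_smul, neg_mul, mul_neg, smul_neg,
      mul_assoc, h.e_wpinv, mul_smul_comm]
    rw [← mul_assoc, ← mul_assoc, h.comm (.winv i) (.wpinv j) trivial trivial]
  wp_f j i := by
    simp only [QuantumDatum.antipodeGen, ← op_mul, ← op_smul, neg_mul, mul_neg, smul_neg]
    rw [mul_assoc, h.comm (.wpinv i) (.wpinv j) trivial trivial, ← mul_assoc, h.f_wpinv,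
      smul_mul_assoc, mul_assoc]
  e_f i j := by
    have key : φ (.f j) * φ (.wpinv j) * (φ (.winv i) * φ (.e i))
        = φ (.winv i) * (φ (.f j) * φ (.e i)) * φ (.wpinv j) := by
      rw [mul_assoc, ← mul_assoc (φ (.wpinv j)), h.comm (.wpinv j) (.winv i) trivial trivial,
        mul_assoc, h.wpinv_e, ← mul_assoc, h.f_winv, mul_smul_comm, smul_mul_assoc,
        smul_inv_smul₀ (D.q_ne_zero i j)]
      simp only [mul_assoc]
    have expand : φ (.f j) * φ (.wpinv j) * (φ (.winv i) * φ (.e i))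
          - φ (.winv i) * φ (.e i) * (φ (.f j) * φ (.wpinv j))
        = -(φ (.winv i) * (φ (.e i) * φ (.f j) - φ (.f j) * φ (.e i)) * φ (.wpinv j)) := by
      rw [key]
      noncomm_ring
    simp only [QuantumDatum.antipodeGen, ← op_mul, ← op_sub, neg_mul, mul_neg, neg_neg, expand,
      h.e_f]
    split_ifs with hij
    · subst hij
      rw [mul_smul_comm, smul_mul_assoc, mul_sub, sub_mul, h.winv_w, one_mul, mul_assoc,
        h.wp_wpinv, mul_one, ← smul_neg, neg_sub, op_smul, op_sub]
    · simp
  e_e i j hij := by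
    have hq := D.q_orthogonal i j hij
    have hxx := sub_eq_zero.1 (h.e_e i j hij)
    have h₁ := h.e_winv i j
    have h₂ := h.e_winv j i
    rw [hq.2, one_smul] at h₁
    rw [hq.1, one_smul] at h₂
    simp only [QuantumDatum.antipodeGen, ← op_mul, neg_mul, mul_neg, neg_neg]
    rw [sub_eq_zero, mul_assoc, ← mul_assoc (φ (.e j)), h₂, mul_assoc, ← mul_assoc,
      h.comm (.winv j) (.winv i) trivial trivial, ← hxx, mul_assoc (φ (.winv i)) (φ (.e i)),
      ← mul_assoc (φ (.e i)) (φ (.winv j)), h₁]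
    simp only [mul_assoc]
  f_f i j hij := by
    have hq := D.q_orthogonal i j hij
    have hxx := sub_eq_zero.1 (h.f_f i j hij)
    have h₁ := h.wpinv_f i j
    have h₂ := h.wpinv_f j i
    rw [hq.1, inv_one, one_smul] at h₁
    rw [hq.2, inv_one, one_smul] at h₂
    simp only [QuantumDatum.antipodeGen, ← op_mul, neg_mul, mul_neg, neg_neg]
    rw [sub_eq_zero, mul_assoc, ← mul_assoc (φ (.wpinv j)), h₁, mul_assoc, ← mul_assoc,
      h.comm (.wpinv j) (.wpinv i) trivial trivial, ← hxx, mul_assoc (φ (.f i)) (φ (.wpinv i)),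
      ← mul_assoc (φ (.wpinv i)) (φ (.f j)), h₂]
    simp only [mul_assoc]
  quadratic_e i j hij := by
    simp only [QuantumDatum.antipodeGen]
    rw [← op_serre₂Rev, serre₂Rev_neg_mul (t := D.q j i) (by ring)
      (by linear_combination D.q_quadratic i j hij) (h.comm (.winv j) (.winv i) trivial trivial)
      (h.e_winv i i) (h.e_winv j i) (h.e_winv i j) (h.quadratic_e i j hij), op_zero]
  quadratic_f i j hij := by
    have hq := D.q_quadratic i j hij
    have hi := D.q_ne_zero i i
    have hj := D.q_ne_zero i j
    have hji := D.q_ne_zero j i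
    simp only [QuantumDatum.antipodeGen]
    rw [← op_serre₂, serre₂_neg_mul (a := (D.q i i)⁻¹) (b := (D.q j i)⁻¹) (t := (D.q i j)⁻¹)
      (by field_simp; grind) (by field_simp; grind)
      (h.comm (.wpinv i) (.wpinv j) trivial trivial)
      (h.wpinv_f i i) (h.wpinv_f j i) (h.wpinv_f i j) (h.quadratic_f i j hij), op_zero]
  cubic_e i j hij := by
    simp only [QuantumDatum.antipodeGen]
    rw [← op_serre₃Rev, serre₃Rev_neg_mul (t := D.q j i) (by ring)
      (by linear_combination D.q_cubic i j hij) (h.comm (.winv j) (.winv i) trivial trivial)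
      (h.e_winv i i) (h.e_winv j i) (h.e_winv i j) (h.cubic_e i j hij), op_zero]
  cubic_f i j hij := by
    have hq := D.q_cubic i j hij
    have hi := D.q_ne_zero i i
    have hj := D.q_ne_zero i j
    have hji := D.q_ne_zero j i
    simp only [QuantumDatum.antipodeGen]
    rw [← op_serre₃, serre₃_neg_mul (a := (D.q i i)⁻¹) (b := (D.q j i)⁻¹) (t := (D.q i j)⁻¹)
      (by field_simp; grind) (by field_simp; grind)
      (h.comm (.wpinv i) (.wpinv j) trivial trivial)
      (h.wpinv_f i i) (h.wpinv_f j i) (h.wpinv_f i j) (h.cubic_f i j hij), op_zero]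

end Realizes

end QuantumDatum


section HopfAxioms

variable {K A : Type*} [Field K] [Ring A] [Algebra K A] {N : ℕ} {φ : Gen N → A}
  {Δ : A →ₐ[K] A ⊗[K] A} {ε : A →ₐ[K] K} {S : A →ₗ[K] A}

open QuantumDatum

lemma comul_coassoc (hgen : Algebra.adjoin K (Set.range φ) = ⊤)
    (hΔ : ∀ g, Δ (φ g) = comulGen K φ g) (x : A) :
    TensorProduct.assoc K A A A (TensorProduct.map Δ.toLinearMap LinearMap.id (Δ x))
      = TensorProduct.map LinearMap.id Δ.toLinearMap (Δ x) := by
  have key : ((Algebra.TensorProduct.assoc K K K A A A).toAlgHom.comp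
      (Algebra.TensorProduct.map Δ (AlgHom.id K A))).comp Δ
      = (Algebra.TensorProduct.map (AlgHom.id K A) Δ).comp Δ := by
    refine AlgHom.ext_of_adjoin_eq_top hgen ?_
    rintro _ ⟨g, rfl⟩
    cases g <;>
      simp [hΔ, comulGen, TensorProduct.add_tmul, TensorProduct.tmul_add,
        Algebra.TensorProduct.one_def, add_assoc]
  exact DFunLike.congr_fun key x

lemma counit_comul_left (hgen : Algebra.adjoin K (Set.range φ) = ⊤)
    (hΔ : ∀ g, Δ (φ g) = comulGen K φ g) (hε : ∀ g, ε (φ g) = counitGen K g) (x : A) :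
    TensorProduct.lid K A (TensorProduct.map ε.toLinearMap LinearMap.id (Δ x)) = x := by
  have key : ((Algebra.TensorProduct.lid K A).toAlgHom.comp
      (Algebra.TensorProduct.map ε (AlgHom.id K A))).comp Δ = AlgHom.id K A := by
    refine AlgHom.ext_of_adjoin_eq_top hgen ?_
    rintro _ ⟨g, rfl⟩
    cases g <;> simp [hΔ, hε, comulGen, counitGen]
  exact DFunLike.congr_fun key x

lemma counit_comul_right (hgen : Algebra.adjoin K (Set.range φ) = ⊤)
    (hΔ : ∀ g, Δ (φ g) = comulGen K φ g) (hε : ∀ g, ε (φ g) = counitGen K g) (x : A) :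
    TensorProduct.rid K A (TensorProduct.map LinearMap.id ε.toLinearMap (Δ x)) = x := by
  have key : ((Algebra.TensorProduct.rid K K A).toAlgHom.comp
      (Algebra.TensorProduct.map (AlgHom.id K A) ε)).comp Δ = AlgHom.id K A := by
    refine AlgHom.ext_of_adjoin_eq_top hgen ?_
    rintro _ ⟨g, rfl⟩
    cases g <;> simp [hΔ, hε, comulGen, counitGen]
  exact DFunLike.congr_fun key x

lemma antipode_mul_left {D : QuantumDatum K N} (h : D.Realizes φ)
    (hgen : Algebra.adjoin K (Set.range φ) = ⊤)
    (hΔ : ∀ g, Δ (φ g) = comulGen K φ g) (hε : ∀ g, ε (φ g) = counitGen K g)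
    (hS_one : S 1 = 1) (hS_mul : ∀ x y, S (x * y) = S y * S x)
    (hS : ∀ g, S (φ g) = unop (antipodeGen φ g)) (x : A) :
    LinearMap.mul' K A (TensorProduct.map S LinearMap.id (Δ x)) = algebraMap K A (ε x) := by
  have hx : x ∈ Algebra.adjoin K (Set.range φ) := hgen ▸ Algebra.mem_top
  induction hx using Algebra.adjoin_induction with
  | mem x hx =>
    obtain ⟨g, rfl⟩ := hx
    rw [hΔ, hε]
    cases g <;> simp [comulGen, counitGen, hS, hS_one, antipodeGen, h.w_winv, h.winv_w,
      h.wp_wpinv, h.wpinv_wp, mul_assoc]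
  | algebraMap a =>
    simp [Algebra.algebraMap_eq_smul_one a, Algebra.TensorProduct.one_def, hS_one]
  | add x y _ _ hx hy => simp only [map_add, hx, hy]
  | mul x y _ _ hx hy =>
    rw [map_mul, mul'_map_left_mul hS_mul hx, hy, map_mul, map_mul, Algebra.smul_def]

lemma antipode_mul_right {D : QuantumDatum K N} (h : D.Realizes φ)
    (hgen : Algebra.adjoin K (Set.range φ) = ⊤)
    (hΔ : ∀ g, Δ (φ g) = comulGen K φ g) (hε : ∀ g, ε (φ g) = counitGen K g)
    (hS_one : S 1 = 1) (hS_mul : ∀ x y, S (x * y) = S y * S x)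
    (hS : ∀ g, S (φ g) = unop (antipodeGen φ g)) (x : A) :
    LinearMap.mul' K A (TensorProduct.map LinearMap.id S (Δ x)) = algebraMap K A (ε x) := by
  have hx : x ∈ Algebra.adjoin K (Set.range φ) := hgen ▸ Algebra.mem_top
  induction hx using Algebra.adjoin_induction with
  | mem x hx =>
    obtain ⟨g, rfl⟩ := hx
    rw [hΔ, hε]
    cases g <;> simp [comulGen, counitGen, hS, hS_one, antipodeGen, h.w_winv, h.winv_w,
      h.wp_wpinv, h.wpinv_wp, ← mul_assoc]
  | algebraMap a =>
    simp [Algebra.TensorProduct.algebraMap_apply, hS_one]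
  | add x y _ _ hx hy => simp only [map_add, hx, hy]
  | mul x y _ _ hx hy =>
    rw [map_mul, mul'_map_right_mul hS_mul hy, hx, map_mul, map_mul, Algebra.smul_def,
      Algebra.commutes]

/-- An algebra generated by a realization of a quantum datum is a Hopf algebra as soon as the
values of the structure maps on generators extend to algebra homomorphisms. -/
lemma exists_hopf {D : QuantumDatum K N} (h : D.Realizes φ)
    (hgen : Algebra.adjoin K (Set.range φ) = ⊤) (Δ : A →ₐ[K] A ⊗[K] A) (ε : A →ₐ[K] K)
    (S' : A →ₐ[K] Aᵐᵒᵖ) (hΔ : ∀ g, Δ (φ g) = comulGen K φ g) (hε : ∀ g, ε (φ g) = counitGen K g)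
    (hS' : ∀ g, S' (φ g) = antipodeGen φ g) :
    ∃ (Δ : A →ₐ[K] (A ⊗[K] A)) (ε : A →ₐ[K] K) (S : A →ₗ[K] A),
      (∀ i : Fin N,
        Δ (φ (.w i)) = φ (.w i) ⊗ₜ[K] φ (.w i) ∧
        Δ (φ (.winv i)) = φ (.winv i) ⊗ₜ[K] φ (.winv i) ∧
        Δ (φ (.wp i)) = φ (.wp i) ⊗ₜ[K] φ (.wp i) ∧
        Δ (φ (.wpinv i)) = φ (.wpinv i) ⊗ₜ[K] φ (.wpinv i) ∧
        Δ (φ (.e i)) = φ (.e i) ⊗ₜ[K] 1 + φ (.w i) ⊗ₜ[K] φ (.e i) ∧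
        Δ (φ (.f i)) = 1 ⊗ₜ[K] φ (.f i) + φ (.f i) ⊗ₜ[K] φ (.wp i)) ∧
      (∀ i : Fin N,
        ε (φ (.w i)) = 1 ∧ ε (φ (.winv i)) = 1 ∧
        ε (φ (.wp i)) = 1 ∧ ε (φ (.wpinv i)) = 1 ∧
        ε (φ (.e i)) = 0 ∧ ε (φ (.f i)) = 0) ∧
      S 1 = 1 ∧ (∀ x y, S (x * y) = S y * S x) ∧
      (∀ i : Fin N,
        S (φ (.w i)) = φ (.winv i) ∧ S (φ (.winv i)) = φ (.w i) ∧
        S (φ (.wp i)) = φ (.wpinv i) ∧ S (φ (.wpinv i)) = φ (.wp i) ∧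
        S (φ (.e i)) = -(φ (.winv i) * φ (.e i)) ∧
        S (φ (.f i)) = -(φ (.f i) * φ (.wpinv i))) ∧
      (∀ x, (TensorProduct.assoc K A A A)
          ((TensorProduct.map Δ.toLinearMap LinearMap.id) (Δ x))
        = (TensorProduct.map LinearMap.id Δ.toLinearMap) (Δ x)) ∧
      (∀ x, (TensorProduct.lid K A)
          ((TensorProduct.map ε.toLinearMap LinearMap.id) (Δ x)) = x) ∧
      (∀ x, (TensorProduct.rid K A)
          ((TensorProduct.map LinearMap.id ε.toLinearMap) (Δ x)) = x) ∧
      (∀ x, (LinearMap.mul' K A) ((TensorProduct.map S LinearMap.id) (Δ x))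
        = algebraMap K A (ε x)) ∧
      (∀ x, (LinearMap.mul' K A) ((TensorProduct.map LinearMap.id S) (Δ x))
        = algebraMap K A (ε x)) := by
  let S : A →ₗ[K] A := (opLinearEquiv K).symm.toLinearMap ∘ₗ S'.toLinearMap
  have hS (g) : S (φ g) = unop (antipodeGen φ g) := congrArg unop (hS' g)
  have hS_one : S 1 = 1 := congrArg unop (map_one S')
  have hS_mul (x y) : S (x * y) = S y * S x := congrArg unop (map_mul S' x y)
  exact ⟨Δ, ε, S, fun i => ⟨hΔ _, hΔ _, hΔ _, hΔ _, hΔ _, hΔ _⟩,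
    fun i => ⟨hε _, hε _, hε _, hε _, hε _, hε _⟩, hS_one, hS_mul,
    fun i => ⟨hS _, hS _, hS _, hS _, hS _, hS _⟩,
    comul_coassoc hgen hΔ, counit_comul_left hgen hΔ hε, counit_comul_right hgen hΔ hε,
    antipode_mul_left h hgen hΔ hε hS_one hS_mul hS,
    antipode_mul_right h hgen hΔ hε hS_one hS_mul hS⟩

end HopfAxioms

section TypeC

lemma qr_ne_zero : qr ≠ 0 := by
  simp [qr]

lemma qs_ne_zero : qs ≠ 0 := by
  simp [qs]

/-- The braiding matrix in type `C` of rank `n + 1`: `ω_i e_j ω_i⁻¹ = braidingC n i j • e_j`. -/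
def braidingC (n i j : ℕ) : KK :=
  if i < n then qr ^ ipaC n i j * qs ^ ipaC n (i + 1) j
  else if j < n then qr ^ (2 * ipaC n n j)
  else qr ^ 2 * qs ^ (-2 : ℤ)

lemma braidingC_ne_zero (n i j : ℕ) : braidingC n i j ≠ 0 := by
  have hr := qr_ne_zero
  have hs := qs_ne_zero
  unfold braidingC
  split_ifs <;> positivity

lemma ipaC_swap {n i j : ℕ} (hi : i < n) (hj : j < n) :
    ipaC n (j + 1) i = -ipaC n i j := by
  simp only [ipaC, hi, hj, if_true]
  split_ifs <;> first | rfl | omega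

lemma braidingC_inv {n i j : ℕ} (hi : i ≤ n) (hj : j < n) :
    (braidingC n i j)⁻¹ = qs ^ ipaC n j i * qr ^ ipaC n (j + 1) i := by
  rcases hi.lt_or_eq with hi | rfl
  · have h : ipaC n j i = -ipaC n (i + 1) j := by rw [ipaC_swap hj hi, neg_neg]
    rw [braidingC, if_pos hi, ipaC_swap hi hj, h, mul_inv, zpow_neg, zpow_neg, mul_comm]
  · have h₁ : ipaC i j i = 0 := by simp [ipaC, hj.ne]
    have h₂ : ipaC i (j + 1) i = -(2 * ipaC i i j) := by
      simp only [ipaC, hj, lt_irrefl, if_true, if_false]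
      split_ifs <;> first | rfl | omega
    rw [braidingC, if_neg (lt_irrefl i), if_pos hj, h₁, h₂, zpow_zero, one_mul, zpow_neg]

lemma braidingC_last_right {n j : ℕ} (hj : j < n) :
    (braidingC n j n)⁻¹ = qs ^ (2 * ipaC n n j) := by
  have h₁ : ipaC n j n = 0 := by simp [ipaC, hj.ne]
  have h₂ : ipaC n (j + 1) n = -(2 * ipaC n n j) := by
    simp only [ipaC, hj, lt_irrefl, if_true, if_false]
    split_ifs <;> first | rfl | omega
  rw [braidingC, if_pos hj, h₁, h₂, zpow_zero, one_mul, zpow_neg, inv_inv]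

lemma braidingC_self {n i : ℕ} (hi : i < n) : braidingC n i i = qr * qs⁻¹ := by
  simp [braidingC, ipaC, hi]

lemma braidingC_last_last (n : ℕ) : braidingC n n n = qr ^ 2 * (qs ^ 2)⁻¹ := by
  simp only [braidingC, lt_irrefl, if_false]
  rfl

lemma braidingC_succ_right {n i : ℕ} (hi : i + 1 < n) : braidingC n i (i + 1) = qs := by
  have h : i ≠ i + 1 + 1 := by omega
  simp [h, braidingC, ipaC, hi, (Nat.lt_succ_self i).trans hi]

lemma braidingC_succ_left {n i : ℕ} (hi : i + 1 < n) : braidingC n (i + 1) i = qr⁻¹ := by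
  have h : i + 1 + 1 ≠ i := by omega
  simp [h, braidingC, ipaC, hi, (Nat.lt_succ_self i).trans hi]

lemma braidingC_pred_last {n i : ℕ} (hi : i + 1 = n) : braidingC n i n = qs ^ 2 := by
  subst hi
  simp only [braidingC, ipaC, lt_irrefl, if_true, if_false, Nat.lt_succ_self,
    (Nat.lt_succ_self i).ne, zpow_zero, one_mul]
  rfl

lemma braidingC_last_pred {n i : ℕ} (hi : i + 1 = n) : braidingC n n i = (qr ^ 2)⁻¹ := by
  subst hi
  simp only [braidingC, ipaC, lt_irrefl, if_true, if_false, Nat.lt_succ_self,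
    (Nat.lt_succ_self i).ne']
  rfl

lemma braidingC_eq_one {n i j : ℕ} (hi : i ≤ n) (hj : j ≤ n) (h : i + 1 < j ∨ j + 1 < i) :
    braidingC n i j = 1 := by
  have h₁ : i < n → ipaC n i j = 0 := by unfold ipaC; grind
  have h₂ : i < n → ipaC n (i + 1) j = 0 := by unfold ipaC; grind
  have h₃ : i = n → ipaC n n j = 0 := by unfold ipaC; grind
  have h₄ : i = n → j < n := by omega
  rcases hi.lt_or_eq with hi | hi
  · simp [braidingC, hi, h₁ hi, h₂ hi]
  · simp [braidingC, hi, h₃ hi, h₄ hi]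

/-- The quantum datum of `U_{r,s}(sp_{2(n+1)})`. -/
def datumC (n : ℕ) : QuantumDatum KK (n + 1) where
  q i j := braidingC n i j
  c i := (riC n qr i - riC n qs i)⁻¹
  Orthogonal i j := (i : ℕ) + 1 < j ∨ (j : ℕ) + 1 < i
  Quadratic i j := ((i : ℕ) + 1 = j ∨ (j : ℕ) + 1 = i) ∧ (j : ℕ) < n
  Cubic i j := (i : ℕ) + 1 = n ∧ j = Fin.last n
  q_ne_zero i j := braidingC_ne_zero n i j
  q_orthogonal i j h :=
    ⟨braidingC_eq_one i.is_le j.is_le h, braidingC_eq_one j.is_le i.is_le h.symm⟩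
  q_quadratic i j h := by
    have hr := qr_ne_zero
    have hs := qs_ne_zero
    obtain ⟨hij | hij, hj⟩ := h
    · rw [← hij] at hj ⊢
      rw [braidingC_self (by omega), braidingC_succ_right hj, braidingC_succ_left hj]
      field_simp
    · rcases i.is_le.lt_or_eq with hi | hi
      · rw [← hij] at hi ⊢
        rw [braidingC_self hi, braidingC_succ_right hi, braidingC_succ_left hi]
        field_simp
      · rw [hi] at hij ⊢
        rw [braidingC_last_last, braidingC_pred_last hij, braidingC_last_pred hij]
        field_simp
  q_cubic i j h := by
    have hr := qr_ne_zero
    have hs := qs_ne_zero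
    obtain ⟨hi, rfl⟩ := h
    rw [Fin.val_last, braidingC_self (by omega), braidingC_pred_last hi, braidingC_last_pred hi]
    field_simp

end TypeC

section Presentation

variable {n : ℕ} {A : Type*} [Ring A] [Algebra KK A]

lemma serreC_coeffs {n i j : ℕ} (hij : j = i + 1) (hj : j < n) :
    braidingC n i j * (1 + braidingC n i i) = qr + qs ∧
    braidingC n i j ^ 2 * braidingC n i i = qr * qs ∧
    braidingC n j i * (1 + braidingC n j j) = qr⁻¹ + qs⁻¹ ∧
    braidingC n j i ^ 2 * braidingC n j j = (qr * qs)⁻¹ := by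
  have hr := qr_ne_zero
  have hs := qs_ne_zero
  subst hij
  rw [braidingC_self hj, braidingC_self (by omega : i < n), braidingC_succ_right hj,
    braidingC_succ_left hj]
  refine ⟨?_, ?_, ?_, ?_⟩ <;> field_simp
  all_goals ring

lemma serreC_coeffs_last {n i : ℕ} (hi : i + 1 = n) :
    braidingC n n i * (1 + braidingC n n n) = (riC n qr n)⁻¹ + (riC n qs n)⁻¹ ∧
    braidingC n n i ^ 2 * braidingC n n n = (riC n qr n * riC n qs n)⁻¹ ∧
    braidingC n i n * (1 + braidingC n i i + braidingC n i i ^ 2)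
      = qr ^ 2 + qr * qs + qs ^ 2 ∧
    braidingC n i n ^ 2 * braidingC n i i * (1 + braidingC n i i + braidingC n i i ^ 2)
      = qr * qs * (qr ^ 2 + qr * qs + qs ^ 2) ∧
    braidingC n i n * braidingC n i i = qr * qs := by
  have hr := qr_ne_zero
  have hs := qs_ne_zero
  rw [braidingC_self (by omega : i < n), braidingC_last_last, braidingC_last_pred hi,
    braidingC_pred_last hi]
  simp only [riC, lt_irrefl, if_false]
  refine ⟨?_, ?_, ?_, ?_, ?_⟩ <;> field_simp
  all_goals ring

/-- A conjugation relation is equivalent to a commutation relation up to a scalar. -/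
lemma conj_eq_smul_iff {w v x : A} {a b : KK} (hwv : w * v = 1) (hvw : v * w = 1) (hab : a = b) :
    w * x * v = a • x ↔ w * x = b • (x * w) := by
  subst hab
  constructor <;> intro h
  · rw [← smul_mul_assoc, ← h, mul_assoc, hvw, mul_one]
  · rw [h, smul_mul_assoc, mul_assoc, hwv, mul_one]

lemma braidingC_of_lt {n i : ℕ} (hi : i < n) (j : ℕ) :
    qr ^ ipaC n i j * qs ^ ipaC n (i + 1) j = braidingC n i j := by
  rw [braidingC, if_pos hi]

lemma braidingC_of_lt_inv {n i : ℕ} (hi : i < n) (j : ℕ) :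
    qr ^ (-ipaC n i j) * qs ^ (-ipaC n (i + 1) j) = (braidingC n i j)⁻¹ := by
  rw [braidingC, if_pos hi, mul_inv, zpow_neg, zpow_neg]

lemma braidingC_last_left {n j : ℕ} (hj : j < n) :
    qr ^ (2 * ipaC n n j) = braidingC n n j := by
  rw [braidingC, if_neg (lt_irrefl n), if_pos hj]

lemma braidingC_last_left_inv {n j : ℕ} (hj : j < n) :
    qr ^ (-(2 * ipaC n n j)) = (braidingC n n j)⁻¹ := by
  rw [zpow_neg, braidingC_last_left hj]

lemma braidingC_last_last_inv (n : ℕ) : qr ^ (-2 : ℤ) * qs ^ 2 = (braidingC n n n)⁻¹ := by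
  rw [braidingC_last_last, mul_inv, inv_inv]
  rfl

lemma braidingC_inv_inv {n i j : ℕ} (hi : i ≤ n) (hj : j < n) :
    qs ^ (-ipaC n j i) * qr ^ (-ipaC n (j + 1) i) = braidingC n i j := by
  rw [zpow_neg, zpow_neg, ← mul_inv, ← braidingC_inv hi hj, inv_inv]

lemma braidingC_last_right_inv {n j : ℕ} (hj : j < n) :
    qs ^ (-(2 * ipaC n n j)) = braidingC n j n := by
  rw [zpow_neg, ← braidingC_last_right hj, inv_inv]

lemma braidingC_last_last' (n : ℕ) : qs ^ (-2 : ℤ) * qr ^ 2 = braidingC n n n := by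
  rw [braidingC_last_last, mul_comm]
  rfl

lemma braidingC_last_last_inv' (n : ℕ) : qs ^ 2 * qr ^ (-2 : ℤ) = (braidingC n n n)⁻¹ := by
  rw [mul_comm, braidingC_last_last_inv]

/-- An algebra homomorphism out of the free algebra that respects the relations (C1)–(C7) sends
the generators to a realization of the quantum datum. -/
lemma realizes_of_relC (f : FC n →ₐ[KK] A) (hf : ∀ {a b}, RelC n a b → f a = f b) :
    (datumC n).Realizes fun g => f (XC g) := by
  have hwv (i) : f (XC (.w i)) * f (XC (.winv i)) = 1 := by
    rw [← map_mul, hf (.winv_r i), map_one]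
  have hvw (i) : f (XC (.winv i)) * f (XC (.w i)) = 1 := by
    rw [← map_mul, hf (.winv_l i), map_one]
  have hwv' (i) : f (XC (.wp i)) * f (XC (.wpinv i)) = 1 := by
    rw [← map_mul, hf (.wpinv_r i), map_one]
  have hvw' (i) : f (XC (.wpinv i)) * f (XC (.wp i)) = 1 := by
    rw [← map_mul, hf (.wpinv_l i), map_one]
  refine ⟨fun g g' hg hg' => ?_, hwv, hvw, hwv', hvw', fun j i => ?_, fun j i => ?_,
    fun j i => ?_, fun j i => ?_, fun i j => ?_, fun i j h => ?_, fun i j h => ?_,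
    fun i j h => ?_, fun i j h => ?_, fun i j h => ?_, fun i j h => ?_⟩
  · rw [← map_mul, hf (.comm g g' hg hg'), map_mul]
  · cases j using Fin.lastCases with
    | cast j =>
      refine (conj_eq_smul_iff (hwv _) (hvw _) (braidingC_of_lt j.is_lt i)).1 ?_
      simpa using hf (.c2we i j.castSucc j.is_lt)
    | last =>
      cases i using Fin.lastCases with
      | cast i =>
        refine (conj_eq_smul_iff (hwv _) (hvw _) (braidingC_last_left i.is_lt)).1 ?_
        simpa using hf (.c2wne i.castSucc i.is_lt)
      | last =>
        refine (conj_eq_smul_iff (hwv _) (hvw _) ((braidingC_last_last n).symm)).1 ?_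
        simpa using hf .c2wnen
  · cases j using Fin.lastCases with
    | cast j =>
      refine (conj_eq_smul_iff (hwv _) (hvw _) (braidingC_of_lt_inv j.is_lt i)).1 ?_
      simpa using hf (.c2wf i j.castSucc j.is_lt)
    | last =>
      cases i using Fin.lastCases with
      | cast i =>
        refine (conj_eq_smul_iff (hwv _) (hvw _) (braidingC_last_left_inv i.is_lt)).1 ?_
        simpa using hf (.c2wnf i.castSucc i.is_lt)
      | last =>
        refine (conj_eq_smul_iff (hwv _) (hvw _) (braidingC_last_last_inv n)).1 ?_
        simpa using hf .c2wnfn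
  · cases j using Fin.lastCases with
    | cast j =>
      refine (conj_eq_smul_iff (hwv' _) (hvw' _) ((braidingC_inv i.is_le j.is_lt).symm)).1 ?_
      simpa using hf (.c3wpe i j.castSucc j.is_lt)
    | last =>
      cases i using Fin.lastCases with
      | cast i =>
        refine (conj_eq_smul_iff (hwv' _) (hvw' _) ((braidingC_last_right i.is_lt).symm)).1 ?_
        simpa using hf (.c3wpne i.castSucc i.is_lt)
      | last =>
        refine (conj_eq_smul_iff (hwv' _) (hvw' _) (braidingC_last_last_inv' n)).1 ?_
        simpa using hf .c3wpnen
  · cases j using Fin.lastCases with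
    | cast j =>
      refine (conj_eq_smul_iff (hwv' _) (hvw' _) (braidingC_inv_inv i.is_le j.is_lt)).1 ?_
      simpa using hf (.c3wpf i j.castSucc j.is_lt)
    | last =>
      cases i using Fin.lastCases with
      | cast i =>
        refine (conj_eq_smul_iff (hwv' _) (hvw' _) (braidingC_last_right_inv i.is_lt)).1 ?_
        simpa using hf (.c3wpnf i.castSucc i.is_lt)
      | last =>
        refine (conj_eq_smul_iff (hwv' _) (hvw' _) (braidingC_last_last' n)).1 ?_
        simpa using hf .c3wpnfn
  · rw [← map_mul, ← map_mul, ← map_sub, hf (.c4 i j)]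
    split_ifs
    · rw [map_smul, map_sub]
      rfl
    · exact map_zero f
  · simpa using hf (.c5e i j h)
  · simpa using hf (.c5f i j h)
  · obtain ⟨hij | hij, hj⟩ := h
    · obtain ⟨h₁, h₂, -, -⟩ := serreC_coeffs hij.symm hj
      change serre₂ (braidingC n i i) (braidingC n i j) _ _ = 0
      rw [serre₂, h₁, h₂]
      simpa using hf (.c6a i j hij.symm (hij ▸ hj))
    · rcases i.is_le.lt_or_eq with hi | hi
      · obtain ⟨-, -, h₁, h₂⟩ := serreC_coeffs hij.symm hi
        change serre₂ (braidingC n i i) (braidingC n i j) _ _ = 0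
        rw [serre₂, h₁, h₂]
        simpa using hf (.c6b j i hij.symm (hij ▸ hi))
      · obtain rfl : i = Fin.last n := Fin.ext hi
        obtain ⟨h₁, h₂, -⟩ := serreC_coeffs_last (n := n) hij
        change serre₂ (braidingC n n n) (braidingC n n j) _ _ = 0
        rw [serre₂, h₁, h₂]
        simpa using hf (.c6d j hij)
  · obtain ⟨hij | hij, hj⟩ := h
    · obtain ⟨h₁, h₂, -, -⟩ := serreC_coeffs hij.symm hj
      change serre₂Rev (braidingC n i i) (braidingC n i j) _ _ = 0
      rw [serre₂Rev, h₁, h₂]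
      simpa using hf (.c7a i j hij.symm (hij ▸ hj))
    · rcases i.is_le.lt_or_eq with hi | hi
      · obtain ⟨-, -, h₁, h₂⟩ := serreC_coeffs hij.symm hi
        change serre₂Rev (braidingC n i i) (braidingC n i j) _ _ = 0
        rw [serre₂Rev, h₁, h₂]
        simpa using hf (.c7b j i hij.symm (hij ▸ hi))
      · obtain rfl : i = Fin.last n := Fin.ext hi
        obtain ⟨h₁, h₂, -⟩ := serreC_coeffs_last (n := n) hij
        change serre₂Rev (braidingC n n n) (braidingC n n j) _ _ = 0
        rw [serre₂Rev, h₁, h₂]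
        simpa using hf (.c7d j hij)
  · obtain ⟨hi, rfl⟩ := h
    obtain ⟨-, -, h₁, h₂, h₃⟩ := serreC_coeffs_last hi
    change serre₃ (braidingC n i i) (braidingC n i n) _ _ = 0
    rw [serre₃, h₁, h₂, h₃]
    simpa using hf (.c6c i hi)
  · obtain ⟨hi, rfl⟩ := h
    obtain ⟨-, -, h₁, h₂, h₃⟩ := serreC_coeffs_last hi
    change serre₃Rev (braidingC n i i) (braidingC n i n) _ _ = 0
    rw [serre₃Rev, h₁, h₂, h₃]
    simpa using hf (.c7c i hi)

/-- An algebra homomorphism out of the free algebra that sends the generators to a realization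
of the quantum datum respects the relations (C1)–(C7). -/
lemma eq_of_relC (f : FC n →ₐ[KK] A) (hf : (datumC n).Realizes fun g => f (XC g)) {a b : FC n}
    (h : RelC n a b) : f a = f b := by
  cases h with
  | comm g g' hg hg' => rw [map_mul, map_mul, hf.comm g g' hg hg']
  | winv_r i => rw [map_mul, hf.w_winv, map_one]
  | winv_l i => rw [map_mul, hf.winv_w, map_one]
  | wpinv_r i => rw [map_mul, hf.wp_wpinv, map_one]
  | wpinv_l i => rw [map_mul, hf.wpinv_wp, map_one]
  | c2we i j hj =>
    rw [map_mul, map_mul, map_smul]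
    exact (conj_eq_smul_iff (hf.w_winv _) (hf.winv_w _) (braidingC_of_lt hj i)).2
      (hf.w_e j i)
  | c2wne j hj =>
    rw [map_mul, map_mul, map_smul]
    exact (conj_eq_smul_iff (hf.w_winv _) (hf.winv_w _) (braidingC_last_left hj)).2
      (hf.w_e _ j)
  | c2wnen =>
    rw [map_mul, map_mul, map_smul]
    exact (conj_eq_smul_iff (hf.w_winv _) (hf.winv_w _) ((braidingC_last_last n).symm)).2
      (hf.w_e _ _)
  | c2wf i j hj =>
    rw [map_mul, map_mul, map_smul]
    exact (conj_eq_smul_iff (hf.w_winv _) (hf.winv_w _) (braidingC_of_lt_inv hj i)).2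
      (hf.w_f j i)
  | c2wnf j hj =>
    rw [map_mul, map_mul, map_smul]
    exact (conj_eq_smul_iff (hf.w_winv _) (hf.winv_w _) (braidingC_last_left_inv hj)).2
      (hf.w_f _ j)
  | c2wnfn =>
    rw [map_mul, map_mul, map_smul]
    exact (conj_eq_smul_iff (hf.w_winv _) (hf.winv_w _) (braidingC_last_last_inv n)).2
      (hf.w_f _ _)
  | c3wpe i j hj =>
    rw [map_mul, map_mul, map_smul]
    exact (conj_eq_smul_iff (hf.wp_wpinv _) (hf.wpinv_wp _) ((braidingC_inv i.is_le hj).symm)).2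
      (hf.wp_e j i)
  | c3wpne j hj =>
    rw [map_mul, map_mul, map_smul]
    exact (conj_eq_smul_iff (hf.wp_wpinv _) (hf.wpinv_wp _) ((braidingC_last_right hj).symm)).2
      (hf.wp_e _ j)
  | c3wpnen =>
    rw [map_mul, map_mul, map_smul]
    exact (conj_eq_smul_iff (hf.wp_wpinv _) (hf.wpinv_wp _) (braidingC_last_last_inv' n)).2
      (hf.wp_e _ _)
  | c3wpf i j hj =>
    rw [map_mul, map_mul, map_smul]
    exact (conj_eq_smul_iff (hf.wp_wpinv _) (hf.wpinv_wp _) (braidingC_inv_inv i.is_le hj)).2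
      (hf.wp_f j i)
  | c3wpnf j hj =>
    rw [map_mul, map_mul, map_smul]
    exact (conj_eq_smul_iff (hf.wp_wpinv _) (hf.wpinv_wp _) (braidingC_last_right_inv hj)).2
      (hf.wp_f _ j)
  | c3wpnfn =>
    rw [map_mul, map_mul, map_smul]
    exact (conj_eq_smul_iff (hf.wp_wpinv _) (hf.wpinv_wp _) (braidingC_last_last' n)).2
      (hf.wp_f _ _)
  | c4 i j =>
    rw [map_sub, map_mul, map_mul, hf.e_f]
    split_ifs
    · rw [map_smul, map_sub]
      rfl
    · exact (map_zero f).symm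
  | c5e i j h => simpa using hf.e_e i j h
  | c5f i j h => simpa using hf.f_f i j h
  | c6a i j hij h =>
    obtain ⟨h₁, h₂, -, -⟩ := serreC_coeffs hij (hij ▸ h)
    have key := hf.quadratic_e i j ⟨.inl hij.symm, hij ▸ h⟩
    change serre₂ (braidingC n i i) (braidingC n i j) _ _ = 0 at key
    rw [serre₂, h₁, h₂] at key
    simpa using key
  | c6b i j hij h =>
    obtain ⟨-, -, h₁, h₂⟩ := serreC_coeffs hij (hij ▸ h)
    have key := hf.quadratic_e j i ⟨.inr hij.symm, by omega⟩
    change serre₂ (braidingC n j j) (braidingC n j i) _ _ = 0 at key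
    rw [serre₂, h₁, h₂] at key
    simpa using key
  | c6c i h =>
    obtain ⟨-, -, h₁, h₂, h₃⟩ := serreC_coeffs_last h
    have key := hf.cubic_e i (Fin.last n) ⟨h, rfl⟩
    change serre₃ (braidingC n i i) (braidingC n i n) _ _ = 0 at key
    rw [serre₃, h₁, h₂, h₃] at key
    simpa using key
  | c6d i h =>
    obtain ⟨h₁, h₂, -⟩ := serreC_coeffs_last h
    have key := hf.quadratic_e (Fin.last n) i ⟨.inr h, by omega⟩
    change serre₂ (braidingC n n n) (braidingC n n i) _ _ = 0 at key
    rw [serre₂, h₁, h₂] at key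
    simpa using key
  | c7a i j hij h =>
    obtain ⟨h₁, h₂, -, -⟩ := serreC_coeffs hij (hij ▸ h)
    have key := hf.quadratic_f i j ⟨.inl hij.symm, hij ▸ h⟩
    change serre₂Rev (braidingC n i i) (braidingC n i j) _ _ = 0 at key
    rw [serre₂Rev, h₁, h₂] at key
    simpa using key
  | c7b i j hij h =>
    obtain ⟨-, -, h₁, h₂⟩ := serreC_coeffs hij (hij ▸ h)
    have key := hf.quadratic_f j i ⟨.inr hij.symm, by omega⟩
    change serre₂Rev (braidingC n j j) (braidingC n j i) _ _ = 0 at key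
    rw [serre₂Rev, h₁, h₂] at key
    simpa using key
  | c7c i h =>
    obtain ⟨-, -, h₁, h₂, h₃⟩ := serreC_coeffs_last h
    have key := hf.cubic_f i (Fin.last n) ⟨h, rfl⟩
    change serre₃Rev (braidingC n i i) (braidingC n i n) _ _ = 0 at key
    rw [serre₃Rev, h₁, h₂, h₃] at key
    simpa using key
  | c7d i h =>
    obtain ⟨h₁, h₂, -⟩ := serreC_coeffs_last h
    have key := hf.quadratic_f (Fin.last n) i ⟨.inr h, by omega⟩
    change serre₂Rev (braidingC n n n) (braidingC n n i) _ _ = 0 at key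
    rw [serre₂Rev, h₁, h₂] at key
    simpa using key

lemma realizes_genC (n : ℕ) : (datumC n).Realizes (genC n) :=
  realizes_of_relC (A := UC n) (RingQuot.mkAlgHom KK (RelC n))
    fun h => RingQuot.mkAlgHom_rel KK h

/-- The algebra homomorphism out of `U_{r,s}(sp_{2(n+1)})` given by a realization. -/
def liftC {φ : Gen (n + 1) → A} (hφ : (datumC n).Realizes φ) : UC n →ₐ[KK] A :=
  RingQuot.liftAlgHom KK ⟨FreeAlgebra.lift KK φ, fun _ _ h => eq_of_relC _ (by
    simpa using hφ) h⟩

@[simp]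
lemma liftC_genC {φ : Gen (n + 1) → A} (hφ : (datumC n).Realizes φ) (g : Gen (n + 1)) :
    liftC hφ (genC n g) = φ g := by
  rw [liftC, genC, RingQuot.liftAlgHom_mkAlgHom_apply, FreeAlgebra.lift_ι_apply]

lemma adjoin_range_genC (n : ℕ) : Algebra.adjoin KK (Set.range (genC n)) = ⊤ := by
  refine Algebra.eq_top_iff.2 fun x => ?_
  obtain ⟨y, rfl⟩ := RingQuot.mkAlgHom_surjective KK (RelC n) x
  induction y using FreeAlgebra.induction with
  | grade0 a => rw [AlgHom.commutes]; exact Subalgebra.algebraMap_mem _ a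
  | grade1 g => exact Algebra.subset_adjoin ⟨g, rfl⟩
  | mul a b ha hb => rw [map_mul]; exact mul_mem ha hb
  | add a b ha hb => rw [map_add]; exact add_mem ha hb

end Presentation

theorem stmt1 (n : ℕ) :
    ∃ (Δ : UC n →ₐ[KK] (UC n ⊗[KK] UC n)) (ε : UC n →ₐ[KK] KK) (S : UC n →ₗ[KK] UC n),
      -- values of Δ on generators
      (∀ i : Fin (n+1),
        Δ (genC n (.w i)) = genC n (.w i) ⊗ₜ[KK] genC n (.w i) ∧
        Δ (genC n (.winv i)) = genC n (.winv i) ⊗ₜ[KK] genC n (.winv i) ∧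
        Δ (genC n (.wp i)) = genC n (.wp i) ⊗ₜ[KK] genC n (.wp i) ∧
        Δ (genC n (.wpinv i)) = genC n (.wpinv i) ⊗ₜ[KK] genC n (.wpinv i) ∧
        Δ (genC n (.e i)) = genC n (.e i) ⊗ₜ[KK] 1 + genC n (.w i) ⊗ₜ[KK] genC n (.e i) ∧
        Δ (genC n (.f i)) = 1 ⊗ₜ[KK] genC n (.f i) + genC n (.f i) ⊗ₜ[KK] genC n (.wp i)) ∧
      -- values of ε on generators
      (∀ i : Fin (n+1),
        ε (genC n (.w i)) = 1 ∧ ε (genC n (.winv i)) = 1 ∧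
        ε (genC n (.wp i)) = 1 ∧ ε (genC n (.wpinv i)) = 1 ∧
        ε (genC n (.e i)) = 0 ∧ ε (genC n (.f i)) = 0) ∧
      -- S is an algebra antihomomorphism with the prescribed generator values
      S 1 = 1 ∧ (∀ x y, S (x * y) = S y * S x) ∧
      (∀ i : Fin (n+1),
        S (genC n (.w i)) = genC n (.winv i) ∧ S (genC n (.winv i)) = genC n (.w i) ∧
        S (genC n (.wp i)) = genC n (.wpinv i) ∧ S (genC n (.wpinv i)) = genC n (.wp i) ∧
        S (genC n (.e i)) = -(genC n (.winv i) * genC n (.e i)) ∧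
        S (genC n (.f i)) = -(genC n (.f i) * genC n (.wpinv i))) ∧
      -- coassociativity
      (∀ x, (TensorProduct.assoc KK (UC n) (UC n) (UC n))
          ((TensorProduct.map Δ.toLinearMap LinearMap.id) (Δ x))
        = (TensorProduct.map LinearMap.id Δ.toLinearMap) (Δ x)) ∧
      -- counit axioms
      (∀ x, (TensorProduct.lid KK (UC n))
          ((TensorProduct.map ε.toLinearMap LinearMap.id) (Δ x)) = x) ∧
      (∀ x, (TensorProduct.rid KK (UC n))
          ((TensorProduct.map LinearMap.id ε.toLinearMap) (Δ x)) = x) ∧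
      -- antipode axioms
      (∀ x, (LinearMap.mul' KK (UC n)) ((TensorProduct.map S LinearMap.id) (Δ x))
        = algebraMap KK (UC n) (ε x)) ∧
      (∀ x, (LinearMap.mul' KK (UC n)) ((TensorProduct.map LinearMap.id S) (Δ x))
        = algebraMap KK (UC n) (ε x)) :=
  have h := realizes_genC n
  exists_hopf h (adjoin_range_genC n) (liftC h.comulGen) (liftC QuantumDatum.Realizes.counitGen)
    (liftC h.antipodeGen) (liftC_genC _) (liftC_genC _) (liftC_genC _)

end
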